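/- arXiv:2005.06593 — 3 statements merged into one kernel-verified Lean document; each statement's English description precedes it below -/
import Mathlib

section
/- Let F ∈ ℂ[X₀,X₁,X₂,X₃,X₄] be an irreducible homogeneous polynomial of degree 3 such that: (i) the Krull dimension of the quotient ring ℂ[X₀,…,X₄]/(F, ∂F/∂X₀, …, ∂F/∂X₄) is at most 2 (i.e., the singular locus of the hypersurface X = {F=0} ⊂ ℙ⁴ has dimension at most 1, so X is normal); and (ii) the only common zero in ℂ⁵ of all second-order partial derivatives ∂²F/∂Xᵢ∂Xⱼ (0 ≤ i, j ≤ 4) is the origin (i.e., X has no point of multiplicity 3, so X is not a cone). Then there exists a 6×6 matrix M of homogeneous linear forms in X₀,…,X₄ with Mᵀ = −M and det M = F². -/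
open MvPolynomial Matrix


/-- Pfaffian matrix -/
def skew6 {R : Type*} [CommRing R] (a b c d e f g h i j k l m n o : R) : Matrix (Fin 6) (Fin 6) R :=
  !![0, a, b, c, d, e;
     -a, 0, f, g, h, i;
     -b, -f, 0, j, k, l;
     -c, -g, -j, 0, m, n;
     -d, -h, -k, -m, 0, o;
     -e, -i, -l, -n, -o, 0]

def pf6 {R : Type*} [CommRing R] (a b c d e f g h i j k l m n o : R) : R :=
  a * (j * o - k * n + l * m) - b * (g * o - h * n + i * m) + c * (f * o - h * l + i * k)
   - d * (f * n - g * l + i * j) + e * (f * m - g * k + h * j)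

set_option maxHeartbeats 4000000 in
theorem det_skew6 {R : Type*} [CommRing R] (a b c d e f g h i j k l m n o : R) :
    (skew6 a b c d e f g h i j k l m n o).det = (pf6 a b c d e f g h i j k l m n o) ^ 2 := by
  unfold skew6 pf6
  simp [Matrix.det_succ_row_zero, Fin.sum_univ_succ, Fin.succAbove, Matrix.submatrix]
  ring

abbrev V5 := Fin 5 → ℂ

/-- linear form of functional -/
noncomputable def lf (φ : V5 →ₗ[ℂ] ℂ) : MvPolynomial (Fin 5) ℂ :=
  ∑ i, C (φ (Pi.single i 1)) * X i

theorem lf_hom (φ : V5 →ₗ[ℂ] ℂ) : (lf φ).IsHomogeneous 1 := by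
  unfold lf
  apply IsHomogeneous.sum
  intro i _
  simpa using (isHomogeneous_C (Fin 5) (φ (Pi.single i 1))).mul (isHomogeneous_X ℂ i)

theorem lf_eval (φ : V5 →ₗ[ℂ] ℂ) (x : V5) : eval x (lf φ) = φ x := by
  unfold lf
  simp only [map_sum, map_mul, eval_C, eval_X]
  conv_rhs => rw [LinearMap.pi_apply_eq_sum_univ φ x]
  apply Finset.sum_congr rfl
  intro i _
  simp only [smul_eq_mul]
  rw [mul_comm]
  congr 2
  ext j
  simp [Pi.single_apply, eq_comm]

/-- Pfaffian: in terms of functionals -/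
def IsPf (f : V5 → ℂ) : Prop :=
  ∃ a b c d e p g h i j k l m n o : V5 →ₗ[ℂ] ℂ, ∀ x,
    f x ^ 2 = (pf6 (a x) (b x) (c x) (d x) (e x) (p x) (g x) (h x) (i x) (j x) (k x) (l x) (m x)
      (n x) (o x)) ^ 2

theorem pf_final (F : MvPolynomial (Fin 5) ℂ) (h : IsPf (fun x => eval x F)) :
    ∃ M : Matrix (Fin 6) (Fin 6) (MvPolynomial (Fin 5) ℂ),
      (∀ i j, (M i j).IsHomogeneous 1) ∧ Mᵀ = -M ∧ M.det = F ^ 2 := by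
  obtain ⟨a, b, c, d, e, p, g, h, i, j, k, l, m, n, o, H⟩ := h
  refine ⟨skew6 (lf a) (lf b) (lf c) (lf d) (lf e) (lf p) (lf g) (lf h) (lf i) (lf j) (lf k) (lf l)
    (lf m) (lf n) (lf o), ?_, ?_, ?_⟩
  · have h0 : (0 : MvPolynomial (Fin 5) ℂ).IsHomogeneous 1 := isHomogeneous_zero _ _ _
    have hl := lf_hom
    have hn : ∀ φ, (-lf φ).IsHomogeneous 1 := fun φ => (lf_hom φ).neg
    intro s t
    fin_cases s <;> fin_cases t <;> simp [skew6, h0, hl, hn]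
  · ext1 s t
    fin_cases s <;> fin_cases t <;> simp [skew6]
  · rw [det_skew6]
    apply MvPolynomial.funext
    intro x
    have := H x
    simp only [map_pow]
    rw [this]
    simp only [pf6, map_add, map_sub, map_mul, lf_eval]

abbrev Tri := V5 →ₗ[ℂ] V5 →ₗ[ℂ] V5 →ₗ[ℂ] ℂ

/-- symmetric trilinear form -/
structure SymT (B : Tri) : Prop where
  h12 : ∀ x y z, B x y z = B y x z
  h23 : ∀ x y z, B x y z = B x z y

/-- the line through x, y lies on the cubic -/
structure J (B : Tri) (x y : V5) : Prop where
  xxx : B x x x = 0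
  xxy : B x x y = 0
  xyy : B x y y = 0
  yyy : B y y y = 0

set_option maxHeartbeats 4000000 in
theorem expand5 (B : Tri) (hB : SymT B) (e0 e1 e2 e3 e4 : V5) (c0 c1 c2 c3 c4 : ℂ) (x : V5)
    (hx : x = c0 • e0 + c1 • e1 + c2 • e2 + c3 • e3 + c4 • e4) :
    B x x x = 1 * B e0 e0 e0 * (c0 * c0 * c0)
      + 3 * B e0 e0 e1 * (c0 * c0 * c1)
      + 3 * B e0 e0 e2 * (c0 * c0 * c2)
      + 3 * B e0 e0 e3 * (c0 * c0 * c3)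
      + 3 * B e0 e0 e4 * (c0 * c0 * c4)
      + 3 * B e0 e1 e1 * (c0 * c1 * c1)
      + 6 * B e0 e1 e2 * (c0 * c1 * c2)
      + 6 * B e0 e1 e3 * (c0 * c1 * c3)
      + 6 * B e0 e1 e4 * (c0 * c1 * c4)
      + 3 * B e0 e2 e2 * (c0 * c2 * c2)
      + 6 * B e0 e2 e3 * (c0 * c2 * c3)
      + 6 * B e0 e2 e4 * (c0 * c2 * c4)
      + 3 * B e0 e3 e3 * (c0 * c3 * c3)
      + 6 * B e0 e3 e4 * (c0 * c3 * c4)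
      + 3 * B e0 e4 e4 * (c0 * c4 * c4)
      + 1 * B e1 e1 e1 * (c1 * c1 * c1)
      + 3 * B e1 e1 e2 * (c1 * c1 * c2)
      + 3 * B e1 e1 e3 * (c1 * c1 * c3)
      + 3 * B e1 e1 e4 * (c1 * c1 * c4)
      + 3 * B e1 e2 e2 * (c1 * c2 * c2)
      + 6 * B e1 e2 e3 * (c1 * c2 * c3)
      + 6 * B e1 e2 e4 * (c1 * c2 * c4)
      + 3 * B e1 e3 e3 * (c1 * c3 * c3)
      + 6 * B e1 e3 e4 * (c1 * c3 * c4)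
      + 3 * B e1 e4 e4 * (c1 * c4 * c4)
      + 1 * B e2 e2 e2 * (c2 * c2 * c2)
      + 3 * B e2 e2 e3 * (c2 * c2 * c3)
      + 3 * B e2 e2 e4 * (c2 * c2 * c4)
      + 3 * B e2 e3 e3 * (c2 * c3 * c3)
      + 6 * B e2 e3 e4 * (c2 * c3 * c4)
      + 3 * B e2 e4 e4 * (c2 * c4 * c4)
      + 1 * B e3 e3 e3 * (c3 * c3 * c3)
      + 3 * B e3 e3 e4 * (c3 * c3 * c4)
      + 3 * B e3 e4 e4 * (c3 * c4 * c4)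
      + 1 * B e4 e4 e4 * (c4 * c4 * c4) := by
  obtain ⟨h12, h23⟩ := hB
  rw [hx]
  simp only [map_add, map_smul, LinearMap.add_apply, LinearMap.smul_apply, smul_eq_mul]
  simp only [h12 e1 e0, h12 e2 e0, h12 e3 e0, h12 e4 e0, h12 e2 e1, h12 e3 e1, h12 e4 e1,
    h12 e3 e2, h12 e4 e2, h12 e4 e3, h23 _ e1 e0, h23 _ e2 e0, h23 _ e3 e0, h23 _ e4 e0,
    h23 _ e2 e1, h23 _ e3 e1, h23 _ e4 e1, h23 _ e3 e2, h23 _ e4 e2, h23 _ e4 e3]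
  ring

theorem basis_coords (e0 e1 e2 e3 e4 : V5) (h : LinearIndependent ℂ ![e0, e1, e2, e3, e4]) :
    ∃ c0 c1 c2 c3 c4 : V5 →ₗ[ℂ] ℂ, ∀ x,
      x = c0 x • e0 + c1 x • e1 + c2 x • e2 + c3 x • e3 + c4 x • e4 := by
  let b := basisOfLinearIndependentOfCardEqFinrank h (by simp)
  refine ⟨b.coord 0, b.coord 1, b.coord 2, b.coord 3, b.coord 4, fun x => ?_⟩
  conv_lhs => rw [← b.sum_repr x]
  simp [Fin.sum_univ_five, b]

theorem K1 (B : Tri) (hB : SymT B) (u v w1 w2 w3 : V5)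
    (hi : LinearIndependent ℂ ![u, v, w1, w2, w3])
    (h1 : J B u v) (h2 : J B u w1) (h3 : J B v w2) (h4 : J B (u + v) w3) :
    IsPf (fun x => B x x x) := by
  obtain ⟨x, y, w1', w2', w3', hc⟩ := basis_coords u v w1 w2 w3 hi
  obtain ⟨a1, a2⟩ := h4.xxy, h4.xyy
  simp only [map_add, LinearMap.add_apply, hB.h12 v u] at a1 a2
  have b1 : B u v w3 = - (B u u w3 + B v v w3) / 2 := by linear_combination a1 / 2
  have b2 : B v w3 w3 = - B u w3 w3 := by linear_combination a2
  refine ⟨0, w1', 0, w3', x, 0, w2', w3', y,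
    (3 * B u u w3) • x - (3 * B v v w3) • y + (3 * B u w3 w3) • w3',
    - ((3 * B u u w2) • x + (6 * B u v w2) • y + (3 * B u w2 w2) • w2'),
    (6 * B u w2 w3) • x + (6 * B v w2 w3) • y + (3 * B w2 w2 w3) • w2' + (3 * B w2 w3 w3) • w3',
    - ((6 * B u v w1) • x + (3 * B v v w1) • y + (3 * B v w1 w1) • w1'),
    (6 * B u w1 w3) • x + (6 * B v w1 w3) • y + (3 * B w1 w1 w3) • w1' + (3 * B w1 w3 w3) • w3',
    - ((6 * B u w1 w2) • x + (6 * B v w1 w2) • y + (3 * B w1 w1 w2) • w1' + (3 * B w1 w2 w2) • w2'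
      + (6 * B w1 w2 w3) • w3'), fun t => ?_⟩
  simp only
  rw [expand5 B hB u v w1 w2 w3 _ _ _ _ _ t (hc t), b1, b2]
  simp only [h1.xxx, h1.xxy, h1.xyy, h1.yyy, h2.xxy, h2.xyy, h2.yyy, h3.xxy, h3.xyy, h3.yyy, h4.yyy,
    pf6, LinearMap.add_apply, LinearMap.sub_apply, LinearMap.neg_apply, LinearMap.smul_apply,
    LinearMap.zero_apply, smul_eq_mul]
  congr 1
  ring

theorem K2 (B : Tri) (hB : SymT B) (e0 e1 e2 e3 e4 : V5)
    (hi : LinearIndependent ℂ ![e0, e1, e2, e3, e4])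
    (h1 : J B e0 e1) (h2 : J B e0 e2) (h3 : J B e1 e2) (h4 : B e0 e1 e2 = 0) (h5 : J B e3 e4) :
    IsPf (fun x => B x x x) := by
  obtain ⟨x0, x1, x2, x3, x4, hc⟩ := basis_coords _ _ _ _ _ hi
  refine ⟨x3, x4, 0, 0, 0, 0,
    -((3 * B e0 e0 e4) • x0 + (6 * B e0 e1 e4) • x1 + (6 * B e0 e2 e4) • x2 + (3 * B e0 e4 e4) • x4),
    -((3 * B e1 e1 e4) • x1 + (6 * B e1 e2 e4) • x2 + (3 * B e1 e4 e4) • x4),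
    -((3 * B e2 e2 e4) • x2 + (3 * B e2 e4 e4) • x4),
    (3 * B e0 e0 e3) • x0 + (6 * B e0 e1 e3) • x1 + (6 * B e0 e2 e3) • x2 + (3 * B e0 e3 e3) • x3
      + (6 * B e0 e3 e4) • x4,
    (3 * B e1 e1 e3) • x1 + (6 * B e1 e2 e3) • x2 + (3 * B e1 e3 e3) • x3 + (6 * B e1 e3 e4) • x4,
    (3 * B e2 e2 e3) • x2 + (3 * B e2 e3 e3) • x3 + (6 * B e2 e3 e4) • x4,
    x2, -x1, x0, fun t => ?_⟩
  simp only
  rw [expand5 B hB _ _ _ _ _ _ _ _ _ _ t (hc t)]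
  simp only [h1.xxx, h1.xxy, h1.xyy, h1.yyy, h2.xxy, h2.xyy, h2.yyy, h3.xxy, h3.xyy,
    h4, h5.xxx, h5.xxy, h5.xyy, h5.yyy,
    pf6, LinearMap.add_apply, LinearMap.sub_apply, LinearMap.neg_apply, LinearMap.smul_apply,
    LinearMap.zero_apply, smul_eq_mul]
  congr 1
  ring

theorem K3 (B : Tri) (hB : SymT B) (p p' q' q r : V5)
    (hi : LinearIndependent ℂ ![p, p', q', q, r])
    (h1 : J B p p') (h2 : J B p' q') (h3 : J B q' q) (h4 : J B (p + q) r) (h0 : B p p q ≠ 0) :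
    IsPf (fun x => B x x x) := by
  obtain ⟨x0, x1, x2, x3, x4, hc⟩ := basis_coords _ _ _ _ _ hi
  obtain ⟨a0, a1, a2⟩ := And.intro h4.xxx (And.intro h4.xxy h4.xyy)
  simp only [map_add, LinearMap.add_apply, hB.h12 q p, hB.h23 _ q p] at a0 a1 a2
  have b0 : B p q q = - B p p q := by linear_combination a0 / 3 - h1.xxx / 3 - h3.yyy / 3
  have b1 : B p q r = - (B p p r + B q q r) / 2 := by linear_combination a1 / 2
  have b2 : B q r r = - B p r r := by linear_combination a2
  refine ⟨x4, 0, 0, -x3,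
    (3 * B p p q') • x0 + (6 * B p p' q') • x1 + (3 * B p q' q') • x2 + (6 * B p q' q) • x3
      + (6 * B p q' r) • x4,
    x0, 0, 0,
    (6 * B p p' q) • x0 + (3 * B p' p' q) • x1 + (6 * B p' q' q) • x2 + (3 * B p' q q) • x3
      + (6 * B p' q r) • x4,
    x1,
    -((3 * B p p q)⁻¹ • ((3 * B p p r) • x0 - (3 * B q q r) • x3 + (3 * B p r r) • x4)),
    (3 * B q' q' r) • x2 + (6 * B q' q r) • x3 + (3 * B q' r r) • x4,
    x2,
    (3 * B p p q) • (x0 - x3),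
    (6 * B p p' r) • x0 + (3 * B p' p' r) • x1 + (6 * B p' q' r) • x2 + (3 * B p' r r) • x4,
    fun t => ?_⟩
  simp only
  rw [expand5 B hB _ _ _ _ _ _ _ _ _ _ t (hc t), b0, b1, b2]
  simp only [h1.xxx, h1.xxy, h1.xyy, h1.yyy, h2.xxy, h2.xyy, h2.yyy, h3.xxy, h3.xyy, h3.yyy, h4.yyy,
    pf6, LinearMap.add_apply, LinearMap.sub_apply, LinearMap.neg_apply, LinearMap.smul_apply,
    LinearMap.zero_apply, smul_eq_mul]
  congr 1
  field_simp
  ring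

theorem pderiv_swap (i j : Fin 5) (P : MvPolynomial (Fin 5) ℂ) :
    pderiv i (pderiv j P) = pderiv j (pderiv i P) := by
  have h : ⁅(pderiv i : Derivation ℂ (MvPolynomial (Fin 5) ℂ) (MvPolynomial (Fin 5) ℂ)),
      (pderiv j : Derivation ℂ (MvPolynomial (Fin 5) ℂ) (MvPolynomial (Fin 5) ℂ))⁆ = 0 := by
    apply MvPolynomial.derivation_ext
    intro k
    rw [Derivation.commutator_apply]
    simp [pderiv_X, Pi.single_apply]
    split_ifs <;> simp
  have := congrArg (fun D => D P) h
  simp only [Derivation.commutator_apply, Derivation.zero_apply] at this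
  exact sub_eq_zero.1 this

theorem euler_eval {P : MvPolynomial (Fin 5) ℂ} {n : ℕ} (h : P.IsHomogeneous n) (x : V5) :
    ∑ i, x i * eval x (pderiv i P) = n * eval x P := by
  have := congrArg (eval x) h.sum_X_mul_pderiv
  simpa using this

theorem eval_const {P : MvPolynomial (Fin 5) ℂ} (h : P.IsHomogeneous 0) (x : V5) :
    eval x P = eval 0 P := by
  rw [← totalDegree_zero_iff_isHomogeneous, totalDegree_eq_zero_iff_eq_C] at h
  rw [h]; simp

theorem exists_B (F : MvPolynomial (Fin 5) ℂ) (hF : F.IsHomogeneous 3)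
    (hnocone : ∀ x : Fin 5 → ℂ,
      (∀ i j : Fin 5,
        MvPolynomial.eval x (MvPolynomial.pderiv i (MvPolynomial.pderiv j F)) = 0) → x = 0) :
    ∃ B : Tri, SymT B ∧ (∀ x, eval x F = B x x x) ∧ (∀ s, (∀ x, B x x s = 0) → s = 0) := by
  let T : Fin 5 → Fin 5 → Fin 5 → ℂ := fun i j k => eval 0 (pderiv i (pderiv j (pderiv k F))) / 6
  let B : Tri := ∑ i, ∑ j, ∑ k, T i j k •
    (LinearMap.proj i : V5 →ₗ[ℂ] ℂ).smulRight
      ((LinearMap.proj j : V5 →ₗ[ℂ] ℂ).smulRight (LinearMap.proj k : V5 →ₗ[ℂ] ℂ))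
  have hBa : ∀ x y z, B x y z = ∑ i, ∑ j, ∑ k, T i j k * (x i * (y j * z k)) := by
    intro x y z
    simp [B, LinearMap.sum_apply]
  have T12 : ∀ i j k, T i j k = T j i k := by
    intro i j k; simp only [T]; rw [pderiv_swap]
  have T23 : ∀ i j k, T i j k = T i k j := by
    intro i j k; simp only [T]; rw [pderiv_swap j k]
  have hS : SymT B := by
    constructor
    · intro x y z
      rw [hBa, hBa, Finset.sum_comm]
      refine Finset.sum_congr rfl fun i _ => Finset.sum_congr rfl fun j _ =>
        Finset.sum_congr rfl fun k _ => ?_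
      rw [T12]; ring
    · intro x y z
      rw [hBa, hBa]
      refine Finset.sum_congr rfl fun i _ => ?_
      rw [Finset.sum_comm]
      refine Finset.sum_congr rfl fun j _ =>
        Finset.sum_congr rfl fun k _ => ?_
      rw [T23]; ring
  have h1 : ∀ k, (pderiv k F).IsHomogeneous 2 := fun k => hF.pderiv
  have h2 : ∀ j k, (pderiv j (pderiv k F)).IsHomogeneous 1 := fun j k => (h1 k).pderiv
  have h3 : ∀ i j k, (pderiv i (pderiv j (pderiv k F))).IsHomogeneous 0 := fun i j k => (h2 j k).pderiv
  have e3 : ∀ x j k, eval x (pderiv j (pderiv k F)) = ∑ i, x i * (6 * T i j k) := by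
    intro x j k
    have := euler_eval (h2 j k) x
    simp only [Nat.cast_one, one_mul] at this
    rw [← this]
    refine Finset.sum_congr rfl fun i _ => ?_
    rw [eval_const (h3 i j k)]
    simp only [T]; ring
  refine ⟨B, hS, fun x => ?_, fun s hs => ?_⟩
  · have a1 := euler_eval hF x
    have a2 := fun k => euler_eval (h1 k) x
    push_cast at a1 a2
    have : 6 * eval x F = 6 * B x x x := by
      calc 6 * eval x F = 2 * (3 * eval x F) := by ring
        _ = ∑ k, x k * (2 * eval x (pderiv k F)) := by
            rw [← a1, Finset.mul_sum]
            exact Finset.sum_congr rfl fun i _ => by ring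
        _ = ∑ k, x k * ∑ j, x j * ∑ i, x i * (6 * T i j k) := by
            simp only [← a2, e3]
        _ = 6 * B x x x := by
            rw [hBa]
            simp only [Fin.sum_univ_five]
            ring
    linear_combination this / 6
  · have hp : ∀ x y, B x y s = 0 := by
      intro x y
      have := hs (x + y)
      simp only [map_add, LinearMap.add_apply, hs, hS.h12 y x] at this
      linear_combination this / 2
    apply hnocone
    intro j k
    rw [e3]
    have := hp (Pi.single j 1) (Pi.single k 1)
    rw [hS.h23, hS.h12, hBa] at this
    have h6 : ∑ i, s i * (6 * T i j k) =
      6 * ∑ i, ∑ j', ∑ k', T i j' k' * (s i * ((Pi.single j 1 : V5) j' * (Pi.single k 1 : V5) k')) := by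
      rw [Finset.mul_sum]
      refine Finset.sum_congr rfl fun i _ => ?_
      rw [Finset.sum_eq_single j, Finset.sum_eq_single k]
      · simp; ring
      · intro b _ hb; simp [hb]
      · simp
      · intro b _ hb; simp [hb]
      · simp
    rw [h6, this, mul_zero]

theorem krull_aux (f : Fin 4 → MvPolynomial (Fin 5) ℂ) (h0 : ∀ i, eval 0 (f i) = 0) :
    ∃ x : V5, x ≠ 0 ∧ ∀ i, eval x (f i) = 0 := by
  by_contra hcon
  push Not at hcon
  have hdim : ringKrullDim (MvPolynomial (Fin 5) ℂ) ≤ ((4 : ℕ) : WithBot ℕ∞) := by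
    rw [ringKrullDim_le_iff_isMaximal_height_le]
    intro I hI
    obtain ⟨a, rfl⟩ := isMaximal_iff_eq_vanishingIdeal_singleton.1 hI
    let g : Fin 4 → MvPolynomial (Fin 5) ℂ := fun i => aeval (fun j => X j - C (a j)) (f i)
    have hg : ∀ i y, eval y (g i) = eval (y - a) (f i) := by
      intro i y
      simp only [g]
      rw [← MvPolynomial.coe_aeval_eq_eval, ← MvPolynomial.coe_aeval_eq_eval]
      simp only [RingHom.coe_coe]
      rw [← AlgHom.comp_apply, MvPolynomial.comp_aeval]
      congr 2
      ext j
      simp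
    have hz : zeroLocus ℂ (Ideal.span (Set.range g)) = {a} := by
      rw [zeroLocus_span]
      ext y
      simp only [Set.mem_range, forall_exists_index, forall_apply_eq_imp_iff, Set.mem_ofPred_eq,
        Set.mem_singleton_iff, aeval_eq_eval, hg]
      constructor
      · intro h
        by_contra hne
        obtain ⟨i, hi⟩ := hcon (y - a) (sub_ne_zero.2 hne)
        exact hi (h i)
      · rintro rfl i
        simpa using h0 i
    have hr := vanishingIdeal_zeroLocus_eq_radical (K := ℂ) (Ideal.span (Set.range g))
    rw [hz] at hr
    have hmin : vanishingIdeal ℂ {a} ∈ (Ideal.span (Set.range g)).minimalPrimes := by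
      rw [← Ideal.radical_minimalPrimes, ← hr]
      have := hI.isPrime
      rw [Ideal.minimalPrimes_eq_subsingleton_self]
      rfl
    have := Ideal.height_le_card_of_mem_minimalPrimes_span (Set.finite_range g) hmin
    have h4 : (Set.range g).ncard ≤ 4 := by
      rw [← Set.image_univ]
      refine (Set.ncard_image_le Set.finite_univ).trans ?_
      simp [Set.ncard_univ]
    have h5 : (vanishingIdeal ℂ {a}).height ≤ ((4 : ℕ) : ℕ∞) := this.trans (by exact_mod_cast h4)
    exact WithBot.coe_le_coe.2 h5
  rw [MvPolynomial.ringKrullDim_of_isNoetherianRing] at hdim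
  simp only [ringKrullDim_eq_zero_of_field, Nat.card_eq_fintype_card, Fintype.card_fin, zero_add] at hdim
  exact absurd hdim (by decide)

/-- polynomial function -/
def PolyFn (g : V5 → ℂ) : Prop := ∃ P : MvPolynomial (Fin 5) ℂ, ∀ x, eval x P = g x

theorem PolyFn.add {f g : V5 → ℂ} (hf : PolyFn f) (hg : PolyFn g) : PolyFn (fun x => f x + g x) := by
  obtain ⟨P, hP⟩ := hf
  obtain ⟨Q, hQ⟩ := hg
  exact ⟨P + Q, fun x => by simp [hP, hQ]⟩

theorem PolyFn.mul {f g : V5 → ℂ} (hf : PolyFn f) (hg : PolyFn g) : PolyFn (fun x => f x * g x) := by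
  obtain ⟨P, hP⟩ := hf
  obtain ⟨Q, hQ⟩ := hg
  exact ⟨P * Q, fun x => by simp [hP, hQ]⟩

theorem PolyFn.sub {f g : V5 → ℂ} (hf : PolyFn f) (hg : PolyFn g) : PolyFn (fun x => f x - g x) := by
  obtain ⟨P, hP⟩ := hf
  obtain ⟨Q, hQ⟩ := hg
  exact ⟨P - Q, fun x => by simp [hP, hQ]⟩

theorem PolyFn.const (c : ℂ) : PolyFn (fun _ => c) := ⟨C c, fun x => by simp⟩

theorem PolyFn.lin (φ : V5 →ₗ[ℂ] ℂ) : PolyFn (fun x => φ x) := ⟨lf φ, lf_eval φ⟩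

theorem krull {g0 g1 g2 g3 : V5 → ℂ} (h0 : PolyFn g0) (h1 : PolyFn g1) (h2 : PolyFn g2)
    (h3 : PolyFn g3) (z0 : g0 0 = 0) (z1 : g1 0 = 0) (z2 : g2 0 = 0) (z3 : g3 0 = 0) :
    ∃ x, x ≠ 0 ∧ g0 x = 0 ∧ g1 x = 0 ∧ g2 x = 0 ∧ g3 x = 0 := by
  obtain ⟨P0, k0⟩ := h0
  obtain ⟨P1, k1⟩ := h1
  obtain ⟨P2, k2⟩ := h2
  obtain ⟨P3, k3⟩ := h3
  obtain ⟨x, hx, h⟩ := krull_aux ![P0, P1, P2, P3] (by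
    intro i
    fin_cases i
    · exact (k0 0).trans z0
    · exact (k1 0).trans z1
    · exact (k2 0).trans z2
    · exact (k3 0).trans z3)
  refine ⟨x, hx, ?_, ?_, ?_, ?_⟩
  · rw [← k0]; exact h 0
  · rw [← k1]; exact h 1
  · rw [← k2]; exact h 2
  · rw [← k3]; exact h 3

/-- irreducibility -/
theorem irr_dvd {F P : MvPolynomial (Fin 5) ℂ} (hF : Irreducible F)
    (h : ∀ x, eval x F = 0 → eval x P = 0) : F ∣ P := by
  have hp : Prime F := hF.prime
  have : (Ideal.span {F}).IsPrime := (Ideal.span_singleton_prime hp.ne_zero).2 hp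
  have h2 := MvPolynomial.IsPrime.vanishingIdeal_zeroLocus (K := ℂ) (Ideal.span {F})
  rw [← Ideal.mem_span_singleton, ← h2, mem_vanishingIdeal_iff]
  intro x hx
  rw [zeroLocus_span] at hx
  simp only [Set.mem_singleton_iff, forall_eq, Set.mem_ofPred_eq, aeval_eq_eval] at hx ⊢
  exact h x hx

theorem irr_mul {F : MvPolynomial (Fin 5) ℂ} (hF : Irreducible F) {f g : V5 → ℂ}
    (hf : PolyFn f) (hg : PolyFn g) (f1 : ∃ x, eval x F = 0 ∧ f x ≠ 0)
    (g1 : ∃ x, eval x F = 0 ∧ g x ≠ 0) : ∃ x, eval x F = 0 ∧ f x * g x ≠ 0 := by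
  obtain ⟨P, hP⟩ := hf
  obtain ⟨Q, hQ⟩ := hg
  by_contra hcon
  push Not at hcon
  have : F ∣ P * Q := irr_dvd hF (fun x hx => by simpa [hP, hQ] using hcon x hx)
  rcases hF.prime.dvd_or_dvd this with ⟨R, hR⟩ | ⟨R, hR⟩
  · obtain ⟨x, hx, hx'⟩ := f1
    apply hx'; rw [← hP, hR]; simp [hx]
  · obtain ⟨x, hx, hx'⟩ := g1
    apply hx'; rw [← hQ, hR]; simp [hx]

theorem irr_low {F P : MvPolynomial (Fin 5) ℂ} {n : ℕ} (hF : Irreducible F) (h3 : F.IsHomogeneous 3)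
    (hP : P.IsHomogeneous n) (hn : n < 3) (h0 : ∃ x, eval x P ≠ 0) :
    ∃ x, eval x F = 0 ∧ eval x P ≠ 0 := by
  by_contra hcon
  push Not at hcon
  obtain ⟨R, hR⟩ := irr_dvd hF hcon
  obtain ⟨x, hx⟩ := h0
  have hP0 : P ≠ 0 := by rintro rfl; simp at hx
  have hR0 : R ≠ 0 := by rintro rfl; simp at hR; exact hP0 hR
  have := totalDegree_mul_of_isDomain hF.ne_zero hR0
  rw [← hR, hP.totalDegree hP0, h3.totalDegree hF.ne_zero] at this
  omega

theorem PolyFn.comp {f : V5 → ℂ} (hf : PolyFn f) (L : V5 →ₗ[ℂ] V5) : PolyFn (fun x => f (L x)) := by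
  obtain ⟨P, hP⟩ := hf
  refine ⟨aeval (fun i => lf ((LinearMap.proj i : V5 →ₗ[ℂ] ℂ) ∘ₗ L)) P, fun x => ?_⟩
  simp only
  rw [← hP, ← MvPolynomial.coe_aeval_eq_eval, ← MvPolynomial.coe_aeval_eq_eval]
  simp only [RingHom.coe_coe]
  rw [← AlgHom.comp_apply, MvPolynomial.comp_aeval]
  congr 2
  ext j
  simp [lf_eval, MvPolynomial.coe_aeval_eq_eval]

theorem quad_hom (Q : V5 →ₗ[ℂ] V5 →ₗ[ℂ] ℂ) :
    ∃ P : MvPolynomial (Fin 5) ℂ, P.IsHomogeneous 2 ∧ ∀ x, eval x P = Q x x := by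
  refine ⟨∑ i, X i * lf (Q (Pi.single i 1)), ?_, fun x => ?_⟩
  · apply IsHomogeneous.sum
    intro i _
    exact (isHomogeneous_X ℂ i).mul (lf_hom _)
  · simp only [map_sum, map_mul, eval_X, lf_eval]
    have : Q x = ∑ i, x i • Q (Pi.single i 1) := by
      conv_lhs => rw [pi_eq_sum_univ' x]
      simp only [map_sum, map_smul]
    rw [this]
    simp [LinearMap.sum_apply]

theorem PolyFn.quad (Q : V5 →ₗ[ℂ] V5 →ₗ[ℂ] ℂ) : PolyFn (fun x => Q x x) := by
  obtain ⟨P, _, h⟩ := quad_hom Q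
  exact ⟨P, h⟩

/-- the facts used -/
structure Cub (B : Tri) : Prop where
  sym : SymT B
  poly : PolyFn (fun x => B x x x)
  irr : ∀ f g : V5 → ℂ, PolyFn f → PolyFn g → (∃ x, B x x x = 0 ∧ f x ≠ 0) →
    (∃ x, B x x x = 0 ∧ g x ≠ 0) → (∃ x, B x x x = 0 ∧ f x * g x ≠ 0)
  lin : ∀ φ : V5 →ₗ[ℂ] ℂ, φ ≠ 0 → ∃ x, B x x x = 0 ∧ φ x ≠ 0
  qd : ∀ s, s ≠ 0 → ∃ x, B x x x = 0 ∧ B x x s ≠ 0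

theorem exists_cub (F : MvPolynomial (Fin 5) ℂ) (hF : F.IsHomogeneous 3) (hirr : Irreducible F)
    (hnocone : ∀ x : Fin 5 → ℂ,
      (∀ i j : Fin 5,
        MvPolynomial.eval x (MvPolynomial.pderiv i (MvPolynomial.pderiv j F)) = 0) → x = 0) :
    ∃ B : Tri, Cub B ∧ (∀ x, eval x F = B x x x) := by
  obtain ⟨B, hS, hB, hn⟩ := exists_B F hF hnocone
  refine ⟨B, ⟨hS, ⟨F, hB⟩, ?_, ?_, ?_⟩, hB⟩
  · intro f g hf hg h1 h2
    simp only [← hB] at *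
    exact irr_mul hirr hf hg h1 h2
  · intro φ hφ
    simp only [← hB, ← lf_eval φ]
    refine irr_low hirr hF (lf_hom φ) (by norm_num) ?_
    simp only [lf_eval]
    by_contra h
    push Not at h
    exact hφ (LinearMap.ext h)
  · intro s hs
    obtain ⟨P, hP, h⟩ := quad_hom (B s)
    have h' : ∀ x, B x x s = eval x P := fun x => by rw [h, hS.h23, hS.h12]
    simp only [← hB, h']
    refine irr_low hirr hF hP (by norm_num) ?_
    by_contra hc
    push Not at hc
    exact hs (hn s (fun x => by rw [h', hc]))

theorem fn4 (a b c d : V5) : ∃ φ : V5 →ₗ[ℂ] ℂ, φ ≠ 0 ∧ φ a = 0 ∧ φ b = 0 ∧ φ c = 0 ∧ φ d = 0 := by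
  have hlt : Submodule.span ℂ (Set.range ![a, b, c, d]) < ⊤ := by
    rw [lt_top_iff_ne_top]
    intro h
    have h1 := finrank_range_le_card (R := ℂ) ![a, b, c, d]
    rw [Set.finrank, h] at h1
    simp at h1
  obtain ⟨φ, h0, h⟩ := Submodule.exists_le_ker_of_lt_top _ hlt
  have hm : ∀ i, φ (![a, b, c, d] i) = 0 := fun i => h (Submodule.subset_span ⟨i, rfl⟩)
  exact ⟨φ, h0, hm 0, hm 1, hm 2, hm 3⟩

theorem root2 {f : V5 → ℂ} (hf : PolyFn f) (h0 : f 0 = 0) (a b : V5) :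
    ∃ s t : ℂ, (s ≠ 0 ∨ t ≠ 0) ∧ f (s • a + t • b) = 0 := by
  let p : Fin 5 → (V5 →ₗ[ℂ] ℂ) := fun i => LinearMap.proj i
  let L : V5 →ₗ[ℂ] V5 := (p 0).smulRight a + (p 1).smulRight b
  obtain ⟨x, hx, h2, h3, h4, h⟩ := krull (PolyFn.lin (p 2)) (PolyFn.lin (p 3)) (PolyFn.lin (p 4))
    (hf.comp L) (by simp) (by simp) (by simp) (by simpa using h0)
  refine ⟨x 0, x 1, ?_, by simpa [L, p] using h⟩
  by_contra hc
  push Not at hc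
  apply hx
  ext i
  simp only [p, LinearMap.proj_apply] at h2 h3 h4
  fin_cases i
  · exact hc.1
  · exact hc.2
  · exact h2
  · exact h3
  · exact h4

/-- independence of two vectors -/
def I2 (x y : V5) : Prop := ∀ a b : ℂ, a • x + b • y = 0 → a = 0 ∧ b = 0

theorem LI5 (e0 e1 e2 e3 e4 : V5) (h : ∀ c0 c1 c2 c3 c4 : ℂ,
    c0 • e0 + c1 • e1 + c2 • e2 + c3 • e3 + c4 • e4 = 0 → c0 = 0 ∧ c1 = 0 ∧ c2 = 0 ∧ c3 = 0 ∧ c4 = 0) :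
    LinearIndependent ℂ ![e0, e1, e2, e3, e4] := by
  rw [Fintype.linearIndependent_iff]
  intro g hg
  simp [Fin.sum_univ_five] at hg
  obtain ⟨h0, h1, h2, h3, h4⟩ := h _ _ _ _ _ hg
  intro i
  fin_cases i <;> assumption

theorem line_eval {B : Tri} (hB : SymT B) (m0 m1 : V5) (s t : ℂ) :
    B (s • m0 + t • m1) (s • m0 + t • m1) (s • m0 + t • m1) =
     s ^ 3 * B m0 m0 m0 + 3 * s ^ 2 * t * B m0 m0 m1 + 3 * s * t ^ 2 * B m0 m1 m1
      + t ^ 3 * B m1 m1 m1 := by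
  simp only [map_add, map_smul, LinearMap.add_apply, LinearMap.smul_apply, smul_eq_mul,
    hB.h12 m1 m0, hB.h23 _ m1 m0]
  ring

theorem J.all {B : Tri} {m0 m1 : V5} (h : J B m0 m1) (hB : SymT B) (s t : ℂ) :
    B (s • m0 + t • m1) (s • m0 + t • m1) (s • m0 + t • m1) = 0 := by
  rw [line_eval hB, h.xxx, h.xxy, h.xyy, h.yyy]; ring

theorem J_of_all {B : Tri} {m0 m1 : V5} (hB : SymT B)
    (h : ∀ s t : ℂ, B (s • m0 + t • m1) (s • m0 + t • m1) (s • m0 + t • m1) = 0) : J B m0 m1 := by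
  simp only [line_eval hB] at h
  have a := h 1 0
  have b := h 0 1
  have c := h 1 1
  have d := h 1 (-1)
  constructor
  · linear_combination a
  · linear_combination (c - d) / 6 - b / 3
  · linear_combination (c + d) / 6 - a / 3
  · linear_combination b

theorem J.comb {B : Tri} {m0 m1 : V5} (h : J B m0 m1) (hB : SymT B) (s t u v : ℂ) :
    J B (s • m0 + t • m1) (u • m0 + v • m1) := by
  apply J_of_all hB
  intro a b
  have : a • (s • m0 + t • m1) + b • (u • m0 + v • m1) = (a * s + b * u) • m0 + (a * t + b * v) • m1 := by
    module
  rw [this]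
  exact h.all hB _ _

theorem J.symm {B : Tri} {m0 m1 : V5} (h : J B m0 m1) (hB : SymT B) : J B m1 m0 := by
  simpa using h.comb hB 0 1 1 0

theorem line_through {B : Tri} (hC : Cub B) (x : V5) (hx : x ≠ 0) (hX : B x x x = 0) :
    ∃ y, I2 x y ∧ J B x y := by
  obtain ⟨i, hi⟩ : ∃ i, x i ≠ 0 := by
    by_contra h
    push Not at h
    exact hx (funext h)
  obtain ⟨y, hy, h1, h2, h3, h4⟩ := krull (PolyFn.lin (LinearMap.proj i)) (PolyFn.lin (B x x))
    (PolyFn.quad (B x)) hC.poly (by simp) (by simp) (by simp) (by simp)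
  refine ⟨y, fun a b h => ?_, ⟨hX, h2, h3, h4⟩⟩
  have := congrFun h i
  simp only [LinearMap.proj_apply] at h1
  simp [h1, hi] at this
  subst this
  simp [hy] at h
  exact ⟨rfl, h⟩

/-- resultant -/
def Rm (B : Tri) (m0 m1 x : V5) : ℂ :=
  (B x x m1) ^ 2 * B x m0 m0 - 2 * (B x x m0) * (B x x m1) * B x m0 m1 + (B x x m0) ^ 2 * B x m1 m1

theorem Rm_poly {B : Tri} (hB : SymT B) (m0 m1 : V5) : PolyFn (Rm B m0 m1) := by
  have q : ∀ s, PolyFn (fun x => B x x s) := fun s => by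
    have := PolyFn.quad (B s)
    convert this using 2 with x
    rw [hB.h23, hB.h12]
  have l : ∀ s t, PolyFn (fun x => B x s t) := fun s t => by
    have := PolyFn.lin (B s t)
    convert this using 2 with x
    rw [hB.h12, hB.h23]
  have := ((((q m1).mul (q m1)).mul (l m0 m0)).sub ((((PolyFn.const 2).mul (q m0)).mul (q m1)).mul
    (l m0 m1))).add (((q m0).mul (q m0)).mul (l m1 m1))
  convert this using 2 with x
  unfold Rm
  ring

theorem R_fwd {B : Tri} (hB : SymT B) {m0 m1 x : V5} (hm : J B m0 m1) (hx : B x x x = 0)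
    (hR : Rm B m0 m1 x = 0) : ∃ s t : ℂ, (s ≠ 0 ∨ t ≠ 0) ∧ J B x (s • m0 + t • m1) := by
  by_cases h : B x x m0 = 0 ∧ B x x m1 = 0
  · obtain ⟨s, t, hst, h'⟩ := root2 (PolyFn.quad (B x)) (by simp) m0 m1
    refine ⟨s, t, hst, ⟨hx, ?_, h', hm.all hB _ _⟩⟩
    simp [h.1, h.2]
  · refine ⟨B x x m1, - B x x m0, ?_, ⟨hx, ?_, ?_, hm.all hB _ _⟩⟩
    · by_contra hc
      push Not at hc
      exact h ⟨by simpa using hc.2, hc.1⟩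
    · simp; ring
    · rw [← hR]
      unfold Rm
      simp only [map_add, map_smul, LinearMap.add_apply, LinearMap.smul_apply, smul_eq_mul,
        hB.h23 _ m1 m0]
      ring

theorem R_bwd {B : Tri} (hB : SymT B) {m0 m1 x : V5} {s t : ℂ} (hst : s ≠ 0 ∨ t ≠ 0)
    (h : J B x (s • m0 + t • m1)) : Rm B m0 m1 x = 0 := by
  have h1 := h.xxy
  have h2 := h.xyy
  simp only [map_add, map_smul, LinearMap.add_apply, LinearMap.smul_apply, smul_eq_mul,
        hB.h23 _ m1 m0] at h1 h2
  unfold Rm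
  generalize B x x m0 = a at *
  generalize B x x m1 = b at *
  generalize B x m0 m0 = c at *
  generalize B x m0 m1 = d at *
  generalize B x m1 m1 = e at *
  rcases hst with hs | ht
  · have : s ^ 2 * (b ^ 2 * c - 2 * a * b * d + a ^ 2 * e) = 0 := by
      linear_combination b ^ 2 * h2 + (-2 * b * s * d + e * (s * a - t * b)) * h1
    simpa [hs] using this
  · have : t ^ 2 * (b ^ 2 * c - 2 * a * b * d + a ^ 2 * e) = 0 := by
      linear_combination a ^ 2 * h2 + (-2 * a * t * d + c * (t * b - s * a)) * h1
    simpa [ht] using this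

theorem caseI {B : Tri} (hC : Cub B) (m0 m1 : V5) (hI : I2 m0 m1) (hm : J B m0 m1)
    (hub : ∀ x, B x x x = 0 → Rm B m0 m1 x = 0) : IsPf (fun x => B x x x) := by
  have hB := hC.sym
  have q : ∀ s, PolyFn (fun x => B x x s) := fun s => by
    have := PolyFn.quad (B s)
    convert this using 2 with x
    rw [hB.h23, hB.h12]
  obtain ⟨φ1, hφ1, a10, a11, -, -⟩ := fn4 m0 m1 m1 m1
  obtain ⟨x1, hx1, b1⟩ := hC.lin φ1 hφ1
  obtain ⟨σ1, τ1, n1, J1⟩ := R_fwd hB hm hx1 (hub x1 hx1)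
  have hs1 : σ1 • m0 + τ1 • m1 ≠ 0 := by
    intro h
    obtain ⟨h1, h2⟩ := hI _ _ h
    simp [h1, h2] at n1
  obtain ⟨φ2, hφ2, a20, a21, a22, -⟩ := fn4 m0 m1 x1 x1
  obtain ⟨x2, hx2, b2⟩ := hC.irr _ _ (PolyFn.lin φ2) (q (σ1 • m0 + τ1 • m1)) (hC.lin φ2 hφ2)
    (hC.qd _ hs1)
  obtain ⟨b2, b2'⟩ := mul_ne_zero_iff.1 b2
  obtain ⟨σ2, τ2, n2, J2⟩ := R_fwd hB hm hx2 (hub x2 hx2)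
  have hs2 : σ2 • m0 + τ2 • m1 ≠ 0 := by
    intro h
    obtain ⟨h1, h2⟩ := hI _ _ h
    simp [h1, h2] at n2
  have hD : σ1 * τ2 - τ1 * σ2 ≠ 0 := by
    intro hD
    have e := J2.xxy
    simp only [map_add, map_smul, smul_eq_mul] at e b2'
    have u1 : σ2 * (σ1 * B x2 x2 m0 + τ1 * B x2 x2 m1) = 0 := by
      linear_combination σ1 * e - B x2 x2 m1 * hD
    have u2 : τ2 * (σ1 * B x2 x2 m0 + τ1 * B x2 x2 m1) = 0 := by
      linear_combination τ1 * e + B x2 x2 m0 * hD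
    have v1 := (mul_eq_zero.1 u1).resolve_right b2'
    have v2 := (mul_eq_zero.1 u2).resolve_right b2'
    simp [v1, v2] at n2
  obtain ⟨φ3, hφ3, a30, a31, a32, a33⟩ := fn4 m0 m1 x1 x2
  obtain ⟨x3, hx3, b3⟩ := hC.irr _ _ ((PolyFn.lin φ3).mul (q (σ1 • m0 + τ1 • m1)))
    (q (σ2 • m0 + τ2 • m1)) (hC.irr _ _ (PolyFn.lin φ3) (q (σ1 • m0 + τ1 • m1)) (hC.lin φ3 hφ3)
      (hC.qd _ hs1)) (hC.qd _ hs2)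
  obtain ⟨b3, b3''⟩ := mul_ne_zero_iff.1 b3
  obtain ⟨b3, b3'⟩ := mul_ne_zero_iff.1 b3
  obtain ⟨σ3, τ3, n3, J3⟩ := R_fwd hB hm hx3 (hub x3 hx3)
  set D := σ1 * τ2 - τ1 * σ2 with hDdef
  obtain ⟨α, hα⟩ : ∃ α, α = (σ3 * τ2 - τ3 * σ2) / D := ⟨_, rfl⟩
  obtain ⟨β, hβ⟩ : ∃ β, β = (σ1 * τ3 - τ1 * σ3) / D := ⟨_, rfl⟩
  have c1 : σ3 = α * σ1 + β * σ2 := by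
    rw [hα, hβ]; field_simp; rw [hDdef]; ring
  have c2 : τ3 = α * τ1 + β * τ2 := by
    rw [hα, hβ]; field_simp; rw [hDdef]; ring
  have e3 : α * B x3 x3 (σ1 • m0 + τ1 • m1) + β * B x3 x3 (σ2 • m0 + τ2 • m1) = 0 := by
    have := J3.xxy
    rw [c1, c2] at this
    rw [← this]
    simp only [map_add, map_smul, smul_eq_mul]
    ring
  have hα0 : α ≠ 0 := by
    intro h
    rw [h, zero_mul, zero_add] at e3
    have h' := (mul_eq_zero.1 e3).resolve_right b3''
    rw [c1, c2, h, h'] at n3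
    simp at n3
  have hβ0 : β ≠ 0 := by
    intro h
    rw [h, zero_mul, add_zero] at e3
    have h' := (mul_eq_zero.1 e3).resolve_right b3'
    rw [c1, c2, h, h'] at n3
    simp at n3
  refine K1 B hB (α • (σ1 • m0 + τ1 • m1)) (β • (σ2 • m0 + τ2 • m1)) x1 x2 x3 ?_ ?_ ?_ ?_ ?_
  · apply LI5
    intro k0 k1 k2 k3 k4 h
    have z4 := congrArg φ3 h
    simp [a30, a31, a32, a33, b3] at z4
    subst z4
    have z3 := congrArg φ2 h
    simp [a20, a21, a22, b2] at z3
    subst z3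
    have z2 := congrArg φ1 h
    simp [a10, a11, b1] at z2
    subst z2
    have h' : (k0 * α * σ1 + k1 * β * σ2) • m0 + (k0 * α * τ1 + k1 * β * τ2) • m1 = 0 := by
      rw [← h]; module
    obtain ⟨u1, u2⟩ := hI _ _ h'
    have w1 : k0 * α * D = 0 := by
      rw [hDdef]; linear_combination τ2 * u1 - σ2 * u2
    have w2 : k1 * β * D = 0 := by
      rw [hDdef]; linear_combination σ1 * u2 - τ1 * u1
    simp [hα0, hβ0, hD] at w1 w2
    exact ⟨w1, w2, rfl, rfl, rfl⟩
  · have := hm.comb hB (α * σ1) (α * τ1) (β * σ2) (β * τ2)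
    convert this using 1 <;> module
  · have := J1.comb hB 0 α 1 0
    convert this using 1 <;> module
  · have := J2.comb hB 0 β 1 0
    convert this using 1 <;> module
  · have := J3.symm hB
    convert this using 1
    rw [c1, c2]; module

/-- plane in the cubic -/
structure Pl (B : Tri) (e1 e2 e3 : V5) : Prop where
  j12 : J B e1 e2
  j13 : J B e1 e3
  j23 : J B e2 e3
  t : B e1 e2 e3 = 0
  ind : ∀ a b c : ℂ, a • e1 + b • e2 + c • e3 = 0 → a = 0 ∧ b = 0 ∧ c = 0

theorem Pl.all {B : Tri} (hB : SymT B) {e1 e2 e3 : V5} (h : Pl B e1 e2 e3) (a b c : ℂ) (x : V5)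
    (hx : x = a • e1 + b • e2 + c • e3) : B x x x = 0 := by
  rw [expand5 B hB e1 e2 e3 0 0 a b c 0 0 x (by rw [hx]; simp)]
  simp [h.j12.xxx, h.j12.xxy, h.j12.xyy, h.j12.yyy, h.j13.xxy, h.j13.xyy, h.j13.yyy,
    h.j23.xxy, h.j23.xyy, h.t]

theorem Pl.joined {B : Tri} (hB : SymT B) {e1 e2 e3 : V5} (h : Pl B e1 e2 e3) (a b c a' b' c' : ℂ) :
    J B (a • e1 + b • e2 + c • e3) (a' • e1 + b' • e2 + c' • e3) := by
  apply J_of_all hB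
  intro s t
  apply h.all hB (s * a + t * a') (s * b + t * b') (s * c + t * c')
  module

theorem planeLine {B : Tri} (hC : Cub B) {e1 e2 e3 : V5} (h : Pl B e1 e2 e3) (x : V5) (hx : x ≠ 0)
    (hX : B x x x = 0) : IsPf (fun x => B x x x) ∨
      ∃ a b c : ℂ, a • e1 + b • e2 + c • e3 ≠ 0 ∧ J B x (a • e1 + b • e2 + c • e3) := by
  have hB := hC.sym
  obtain ⟨y, hI, hJ⟩ := line_through hC x hx hX
  by_cases hl : LinearIndependent ℂ ![e1, e2, e3, x, y]
  · left
    exact K2 B hB _ _ _ _ _ hl h.j12 h.j13 h.j23 h.t hJ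
  · right
    have : ∃ c0 c1 c2 c3 c4 : ℂ, c0 • e1 + c1 • e2 + c2 • e3 + c3 • x + c4 • y = 0 ∧
        ¬ (c0 = 0 ∧ c1 = 0 ∧ c2 = 0 ∧ c3 = 0 ∧ c4 = 0) := by
      by_contra hc
      push Not at hc
      apply hl
      apply LI5
      intro c0 c1 c2 c3 c4 h5
      by_contra h6
      push Not at h6
      have := hc c0 c1 c2 c3 c4 h5
      tauto
    obtain ⟨c0, c1, c2, c3, c4, hr, hn⟩ := this
    refine ⟨c0, c1, c2, ?_, ?_⟩
    · intro hz
      obtain ⟨rfl, rfl, rfl⟩ := h.ind _ _ _ hz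
      obtain ⟨rfl, rfl⟩ := hI c3 c4 (by rw [← hr]; module)
      simp at hn
    · have e : c0 • e1 + c1 • e2 + c2 • e3 = (-c3) • x + (-c4) • y := by
        rw [← sub_eq_zero, ← hr]; module
      rw [e]
      simpa using hJ.comb hB 1 0 (-c3) (-c4)

theorem caseII {B : Tri} (hC : Cub B) {e1 e2 e3 : V5} (h : Pl B e1 e2 e3) :
    IsPf (fun x => B x x x) := by
  have hB := hC.sym
  have q : ∀ s, PolyFn (fun x => B x x s) := fun s => by
    have := PolyFn.quad (B s)
    convert this using 2 with x
    rw [hB.h23, hB.h12]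
  obtain ⟨φ, hφ, f1, f2, f3, -⟩ := fn4 e1 e2 e3 e3
  obtain ⟨x, hx, fx⟩ := hC.lin φ hφ
  have hx0 : x ≠ 0 := by rintro rfl; simp at fx
  rcases planeLine hC h x hx0 hx with hh | ⟨a, b, c, hz, hJ⟩
  · exact hh
  obtain ⟨φ', hφ', g1, g2, g3, gx⟩ := fn4 e1 e2 e3 x
  obtain ⟨x', hx', k⟩ := hC.irr _ _ (PolyFn.lin φ') (q _) (hC.lin φ' hφ') (hC.qd _ hz)
  obtain ⟨k1, k2⟩ := mul_ne_zero_iff.1 k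
  have hx0' : x' ≠ 0 := by rintro rfl; simp at k1
  rcases planeLine hC h x' hx0' hx' with hh | ⟨a', b', c', hz', hJ'⟩
  · exact hh
  have hI : I2 (a • e1 + b • e2 + c • e3) (a' • e1 + b' • e2 + c' • e3) := by
    intro s t hst
    have := congrArg (B x' x') hst
    rw [map_add, map_smul, map_smul, hJ'.xxy] at this
    simp only [smul_eq_mul, mul_zero, add_zero, map_zero] at this
    have := (mul_eq_zero.1 this).resolve_right k2
    subst this
    rw [zero_smul, zero_add] at hst
    exact ⟨rfl, (smul_eq_zero.1 hst).resolve_right hz'⟩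
  have hl : LinearIndependent ℂ ![e1, e2, e3, x, x'] := by
    apply LI5
    intro c0 c1 c2 c3 c4 hr
    have z4 := congrArg φ' hr
    simp [g1, g2, g3, gx, k1] at z4
    subst z4
    have z3 := congrArg φ hr
    simp [f1, f2, f3, fx] at z3
    subst z3
    obtain ⟨h0, h1, h2⟩ := h.ind c0 c1 c2 (by rw [← hr]; module)
    exact ⟨h0, h1, h2, rfl, rfl⟩
  obtain ⟨ψ, hψ, p1, p2, p3, p4⟩ := fn4 (a • e1 + b • e2 + c • e3) (a' • e1 + b' • e2 + c' • e3) x x'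
  obtain ⟨a3, b3, c3, hw⟩ : ∃ a3 b3 c3 : ℂ, ψ (a3 • e1 + b3 • e2 + c3 • e3) ≠ 0 := by
    by_contra hc
    push Not at hc
    have u1 := hc 1 0 0
    have u2 := hc 0 1 0
    have u3 := hc 0 0 1
    simp at u1 u2 u3
    obtain ⟨d0, d1, d2, d3, d4, hd⟩ := basis_coords _ _ _ _ _ hl
    apply hψ
    ext1 i
    apply LinearMap.ext
    intro t
    simp only [LinearMap.comp_apply]
    rw [hd (LinearMap.single ℂ (fun _ => ℂ) i t)]
    simp [u1, u2, u3, p3, p4]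
  refine K1 B hB (a • e1 + b • e2 + c • e3) (a' • e1 + b' • e2 + c' • e3) x x'
    (a3 • e1 + b3 • e2 + c3 • e3) ?_ (h.joined hB _ _ _ _ _ _) (hJ.symm hB) (hJ'.symm hB) ?_
  · apply LI5
    intro c0 c1 c2 c3 c4 hr
    have z4 := congrArg ψ hr
    rw [map_add, map_add, map_add, map_add, map_smul, map_smul, map_smul, map_smul, map_smul,
      p1, p2, p3, p4] at z4
    simp only [smul_eq_mul, mul_zero, zero_add, map_zero] at z4
    have z4 := (mul_eq_zero.1 z4).resolve_right hw
    subst z4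
    have z4 := congrArg φ' hr
    simp [g1, g2, g3, gx, k1] at z4
    subst z4
    have z3 := congrArg φ hr
    simp [f1, f2, f3, fx] at z3
    subst z3
    obtain ⟨h0, h1⟩ := hI c0 c1 (by rw [← hr]; module)
    exact ⟨h0, h1, rfl, rfl, rfl⟩
  · have := h.joined hB (a + a') (b + b') (c + c') a3 b3 c3
    convert this using 1; module

theorem ker3 (A B C : ℂ) (h : ¬ (A = 0 ∧ B = 0 ∧ C = 0)) :
    ∃ a1 b1 c1 a2 b2 c2 : ℂ, (∀ s t : ℂ, s * a1 + t * a2 = 0 → s * b1 + t * b2 = 0 →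
      s * c1 + t * c2 = 0 → s = 0 ∧ t = 0) ∧
      A * a1 + B * b1 + C * c1 = 0 ∧ A * a2 + B * b2 + C * c2 = 0 ∧
      ∀ a b c : ℂ, A * a + B * b + C * c = 0 → ∃ s t : ℂ, a = s * a1 + t * a2 ∧ b = s * b1 + t * b2 ∧
        c = s * c1 + t * c2 := by
  by_cases hA : A = 0
  · by_cases hB : B = 0
    · have hC : C ≠ 0 := fun hC => h ⟨hA, hB, hC⟩
      subst hA hB
      refine ⟨1, 0, 0, 0, 1, 0, by simp, by simp, by simp, fun a b c hh => ⟨a, b, ?_⟩⟩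
      simp [hC] at hh
      simp [hh]
    · subst hA
      refine ⟨1, 0, 0, 0, -C, B, ?_, by simp, by ring, fun a b c hh => ⟨a, c / B, ?_⟩⟩
      · intro s t h1 h2 h3
        simp [hB] at h1 h3
        exact ⟨h1, h3⟩
      · refine ⟨by ring, ?_, by field_simp; ring⟩
        field_simp
        linear_combination hh
  · refine ⟨-B, A, 0, -C, 0, A, ?_, by ring, by ring, fun a b c hh => ⟨b / A, c / A, ?_⟩⟩
    · intro s t h1 h2 h3
      simp [hA] at h2 h3
      exact ⟨h2, h3⟩
    · refine ⟨?_, by field_simp; ring, by field_simp; ring⟩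
      field_simp
      linear_combination hh

/-- no hub lines -/
def NoHub (B : Tri) : Prop := ∀ m0 m1, I2 m0 m1 → J B m0 m1 → ∃ x, B x x x = 0 ∧ Rm B m0 m1 x ≠ 0

theorem III_plane {B : Tri} (hC : Cub B) (hub : NoHub B) (npl : ∀ e1 e2 e3, ¬ Pl B e1 e2 e3)
    (u v w : V5) (ind : ∀ a b c : ℂ, a • u + b • v + c • w = 0 → a = 0 ∧ b = 0 ∧ c = 0)
    (h1 : J B u v) (h2 : J B v w) :
    ∃ f, PolyFn f ∧ (∃ x, B x x x = 0 ∧ f x ≠ 0) ∧ ∀ y, f y ≠ 0 →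
      ∀ a b c : ℂ, J B y (a • u + b • v + c • w) → a = 0 ∧ b = 0 ∧ c = 0 := by
  have hB := hC.sym
  have hF : ∀ a b c : ℂ, ∀ x, x = a • u + b • v + c • w → B x x x =
      a * c * (3 * B u u w * a + 6 * B u v w * b + 3 * B u w w * c) := by
    intro a b c x hx
    rw [expand5 B hB u v w 0 0 a b c 0 0 x (by rw [hx]; simp)]
    simp [h1.xxx, h1.xxy, h1.xyy, h1.yyy, h2.xxy, h2.xyy, h2.yyy]
    ring
  have hn : ¬ (3 * B u u w = 0 ∧ 6 * B u v w = 0 ∧ 3 * B u w w = 0) := by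
    rintro ⟨k1, k2, k3⟩
    simp at k1 k2 k3
    exact npl u v w ⟨h1, ⟨h1.xxx, k1, k3, h2.yyy⟩, h2, k2, ind⟩
  obtain ⟨a1, b1, c1, a2, b2, c2, li, z1, z2, hsp⟩ := ker3 _ _ _ hn
  have hI : I2 (a1 • u + b1 • v + c1 • w) (a2 • u + b2 • v + c2 • w) := by
    intro s t hst
    obtain ⟨k1, k2, k3⟩ := ind (s * a1 + t * a2) (s * b1 + t * b2) (s * c1 + t * c2)
      (by rw [← hst]; module)
    exact li s t k1 k2 k3
  have hJ : J B (a1 • u + b1 • v + c1 • w) (a2 • u + b2 • v + c2 • w) := by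
    apply J_of_all hB
    intro s t
    rw [hF (s * a1 + t * a2) (s * b1 + t * b2) (s * c1 + t * c2) _ (by module)]
    linear_combination (s * a1 + t * a2) * (s * c1 + t * c2) * (s * z1 + t * z2)
  have I1 : I2 u v := by
    intro s t hst
    obtain ⟨k1, k2, k3⟩ := ind s t 0 (by rw [← hst]; module)
    exact ⟨k1, k2⟩
  have I3 : I2 v w := by
    intro s t hst
    obtain ⟨k1, k2, k3⟩ := ind 0 s t (by rw [← hst]; module)
    exact ⟨k2, k3⟩
  have P1 := Rm_poly hB u v
  have P2 := Rm_poly hB v w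
  have P3 := Rm_poly hB (a1 • u + b1 • v + c1 • w) (a2 • u + b2 • v + c2 • w)
  refine ⟨_, (P1.mul P2).mul P3, hC.irr _ _ (P1.mul P2) P3 (hC.irr _ _ P1 P2 (hub _ _ I1 h1)
    (hub _ _ I3 h2)) (hub _ _ hI hJ), ?_⟩
  intro y hy a b c hj
  obtain ⟨hy, y3⟩ := mul_ne_zero_iff.1 hy
  obtain ⟨y1, y2⟩ := mul_ne_zero_iff.1 hy
  have hz := hj.yyy
  rw [hF a b c _ rfl] at hz
  rcases mul_eq_zero.1 hz with hz | hz
  · rcases mul_eq_zero.1 hz with rfl | rfl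
    · by_contra hcon
      refine y2 (R_bwd hB (s := b) (t := c) ?_ (by simpa using hj))
      by_contra hh
      push Not at hh
      exact hcon ⟨rfl, hh.1, hh.2⟩
    · by_contra hcon
      refine y1 (R_bwd hB (s := a) (t := b) ?_ (by simpa using hj))
      by_contra hh
      push Not at hh
      exact hcon ⟨hh.1, hh.2, rfl⟩
  · obtain ⟨s, t, ea, eb, ec⟩ := hsp a b c hz
    by_contra hcon
    refine y3 (R_bwd hB (s := s) (t := t) ?_ ?_)
    · by_contra hh
      push Not at hh
      simp [ea, eb, ec, hh.1, hh.2] at hcon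
    · convert hj using 1
      rw [ea, eb, ec]; module

theorem III_setup {B : Tri} (hC : Cub B) (hub : NoHub B) : ∃ p1 p' q' q1 : V5,
    (∀ a b c d : ℂ, a • p1 + b • p' + c • q' + d • q1 = 0 → a = 0 ∧ b = 0 ∧ c = 0 ∧ d = 0) ∧
    J B p1 p' ∧ J B p' q' ∧ J B q' q1 := by
  have hB := hC.sym
  obtain ⟨c0, hc0, hc0'⟩ := hC.lin (LinearMap.proj 0) (by
    intro h
    have := congrArg (fun φ => φ (Pi.single 0 1)) h
    simp at this)
  obtain ⟨c1, Ic, Jc⟩ := line_through hC c0 (by rintro rfl; simp at hc0') hc0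
  obtain ⟨x, hx, hR⟩ := hub c0 c1 Ic Jc
  have hx0 : x ≠ 0 := by rintro rfl; simp [Rm] at hR
  obtain ⟨y, Ia, Ja⟩ := line_through hC x hx0 hx
  obtain ⟨s, t, hst, hRp⟩ := root2 (Rm_poly hB c0 c1) (by simp [Rm]) x y
  obtain ⟨σ, τ, hστ, hJ⟩ := R_fwd hB Jc (Ja.all hB s t) hRp
  have ht : t ≠ 0 := by
    rintro rfl
    have hs : s ≠ 0 := by simpa using hst
    have : Rm B c0 c1 (s • x + (0 : ℂ) • y) = s ^ 5 * Rm B c0 c1 x := by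
      simp [Rm]; ring
    rw [this] at hRp
    simp [hs, hR] at hRp
  obtain ⟨μ, ν, hD⟩ : ∃ μ ν : ℂ, σ * ν - τ * μ ≠ 0 := by
    rcases hστ with h | h
    · exact ⟨0, 1, by simpa using h⟩
    · exact ⟨1, 0, by simpa using h⟩
  refine ⟨x, s • x + t • y, σ • c0 + τ • c1, μ • c0 + ν • c1, ?_, ?_, hJ, Jc.comb hB _ _ _ _⟩
  · intro a b c d hr
    have e : (-(c * σ + d * μ)) • c0 + (-(c * τ + d * ν)) • c1 = (a + b * s) • x + (b * t) • y := by
      rw [← sub_eq_zero, ← neg_eq_zero, ← hr]; module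
    have hcd : c * σ + d * μ = 0 ∧ c * τ + d * ν = 0 := by
      by_contra hcon
      refine hR (R_bwd hB (s := -(c * σ + d * μ)) (t := -(c * τ + d * ν)) ?_ ?_)
      · by_contra hh
        push Not at hh
        exact hcon ⟨neg_eq_zero.1 hh.1, neg_eq_zero.1 hh.2⟩
      · rw [e]
        simpa using Ja.comb hB 1 0 (a + b * s) (b * t)
    obtain ⟨k1, k2⟩ := hcd
    have w1 : c * (σ * ν - τ * μ) = 0 := by linear_combination ν * k1 - μ * k2
    have w2 : d * (σ * ν - τ * μ) = 0 := by linear_combination σ * k2 - τ * k1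
    have w1 := (mul_eq_zero.1 w1).resolve_right hD
    have w2 := (mul_eq_zero.1 w2).resolve_right hD
    subst w1 w2
    obtain ⟨v1, v2⟩ := Ia (a + b * s) (b * t) (by rw [← e]; simp)
    have v2 := (mul_eq_zero.1 v2).resolve_right ht
    subst v2
    simp at v1
    exact ⟨v1, rfl, rfl, rfl⟩
  · simpa using Ja.comb hB 1 0 s t

theorem caseIII {B : Tri} (hC : Cub B) (hub : NoHub B) (npl : ∀ e1 e2 e3, ¬ Pl B e1 e2 e3) :
    IsPf (fun x => B x x x) := by
  have hB := hC.sym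
  obtain ⟨p1, p', q', q1, ind, Ja, Jb, Jc⟩ := III_setup hC hub
  obtain ⟨f1, F1, n1, k1⟩ := III_plane hC hub npl p1 p' q' (by
    intro a b c h
    obtain ⟨h1, h2, h3, h4⟩ := ind a b c 0 (by rw [← h]; module)
    exact ⟨h1, h2, h3⟩) Ja Jb
  obtain ⟨f2, F2, n2, k2⟩ := III_plane hC hub npl q1 q' p' (by
    intro a b c h
    obtain ⟨h1, h2, h3, h4⟩ := ind 0 c b a (by rw [← h]; module)
    exact ⟨h4, h3, h2⟩) (Jc.symm hB) (Jb.symm hB)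
  obtain ⟨y, hy, hf⟩ := hC.irr f1 f2 F1 F2 n1 n2
  obtain ⟨hf1, hf2⟩ := mul_ne_zero_iff.1 hf
  replace k1 := k1 y hf1
  replace k2 := k2 y hf2
  have hy0 : y ≠ 0 := by
    rintro rfl
    have := (k1 1 0 0 (by
      refine ⟨by simp, by simp, by simp, ?_⟩
      simpa using Ja.xxx)).1
    simp at this
  obtain ⟨y', Iy, Jy⟩ := line_through hC y hy0 hy
  obtain ⟨h, hh, g1, g2, g3, g4⟩ := fn4 p1 p' q' q1
  obtain ⟨e, he⟩ : ∃ e, h e ≠ 0 := by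
    by_contra hc
    push Not at hc
    exact hh (LinearMap.ext hc)
  have hl : LinearIndependent ℂ ![p1, p', q', q1, e] := by
    apply LI5
    intro d0 d1 d2 d3 d4 hr
    have z := congrArg h hr
    simp [g1, g2, g3, g4, he] at z
    subst z
    obtain ⟨h1, h2, h3, h4⟩ := ind d0 d1 d2 d3 (by rw [← hr]; module)
    exact ⟨h1, h2, h3, h4, rfl⟩
  obtain ⟨d0, d1, d2, d3, d4, hd⟩ := basis_coords _ _ _ _ _ hl
  -- avoidance
  have av1 : ∀ s t : ℂ, (s ≠ 0 ∨ t ≠ 0) → d4 (s • y + t • y') = 0 → d3 (s • y + t • y') ≠ 0 := by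
    intro s t hst h4 h3
    have e1 := hd (s • y + t • y')
    have hJ : J B y (s • y + t • y') := by simpa using Jy.comb hB 1 0 s t
    rw [h4, h3] at e1
    obtain ⟨r0, r1, r2⟩ := k1 (d0 (s • y + t • y')) (d1 (s • y + t • y')) (d2 (s • y + t • y')) (by
      convert hJ using 1
      conv_rhs => rw [e1]
      module)
    rw [r0, r1, r2] at e1
    obtain ⟨s0, t0⟩ := Iy s t (by rw [e1]; module)
    simp [s0, t0] at hst
  have av2 : ∀ s t : ℂ, (s ≠ 0 ∨ t ≠ 0) → d4 (s • y + t • y') = 0 → d0 (s • y + t • y') ≠ 0 := by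
    intro s t hst h4 h3
    have e1 := hd (s • y + t • y')
    have hJ : J B y (s • y + t • y') := by simpa using Jy.comb hB 1 0 s t
    rw [h4, h3] at e1
    obtain ⟨r0, r1, r2⟩ := k2 (d3 (s • y + t • y')) (d2 (s • y + t • y')) (d1 (s • y + t • y')) (by
      convert hJ using 1
      conv_rhs => rw [e1]
      module)
    rw [r0, r1, r2] at e1
    obtain ⟨s0, t0⟩ := Iy s t (by rw [e1]; module)
    simp [s0, t0] at hst
  obtain ⟨s, t, hst, hz⟩ := root2 (PolyFn.lin d4) (by simp) y y'
  have z3 := av1 s t hst hz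
  have z0 := av2 s t hst hz
  have hr : ∃ a b : ℂ, d4 (a • y + b • y') ≠ 0 := by
    by_contra hc
    push Not at hc
    obtain ⟨s, t, hst, hz⟩ := root2 (PolyFn.lin d3) (by simp) y y'
    exact av1 s t hst (hc s t) hz
  obtain ⟨a, b, hr⟩ := hr
  have hJ : J B (s • y + t • y') (a • y + b • y') := Jy.comb hB _ _ _ _
  obtain ⟨r, er⟩ : ∃ r, r = a • y + b • y' := ⟨_, rfl⟩
  obtain ⟨z, ez⟩ : ∃ z, z = s • y + t • y' := ⟨_, rfl⟩
  rw [← er] at hr hJ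
  rw [← ez] at hz z3 z0 hJ
  have hhr : h r ≠ 0 := by
    rw [hd r]
    simp [g1, g2, g3, g4, he, hr]
  obtain ⟨p, hp⟩ : ∃ p, p = d0 z • p1 + d1 z • p' := ⟨_, rfl⟩
  obtain ⟨q, hq⟩ : ∃ q, q = d2 z • q' + d3 z • q1 := ⟨_, rfl⟩
  have hpq : z = p + q := by
    conv_lhs => rw [hd z, hz]
    rw [hp, hq]; module
  have J1 : J B p p' := by
    have := Ja.comb hB (d0 z) (d1 z) 0 1
    rw [hp]; simpa using this
  have J3 : J B q' q := by
    have := Jc.comb hB 1 0 (d2 z) (d3 z)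
    rw [hq]; simpa using this
  rw [hpq] at hJ
  have key : ∀ i0 i1 i2 i3 i4 : ℂ, i0 • p + i1 • p' + i2 • q' + i3 • q + i4 • r = 0 →
      i0 = 0 ∧ i1 = 0 ∧ i2 = 0 ∧ i3 = 0 ∧ i4 = 0 := by
    intro i0 i1 i2 i3 i4 hi
    have z4 := congrArg h hi
    rw [hp, hq] at z4
    simp [g1, g2, g3, g4, hhr] at z4
    subst z4
    rw [hp, hq] at hi
    obtain ⟨w1, w2, w3, w4⟩ := ind (i0 * d0 z) (i0 * d1 z + i1) (i2 + i3 * d2 z) (i3 * d3 z)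
      (by rw [← hi]; module)
    have w1 := (mul_eq_zero.1 w1).resolve_right z0
    have w4 := (mul_eq_zero.1 w4).resolve_right z3
    subst w1 w4
    simp at w2 w3
    exact ⟨rfl, w2, w3, rfl, rfl⟩
  by_cases h0 : B p p q = 0
  · have Jpq : J B p q := by
      refine ⟨J1.xxx, h0, ?_, J3.yyy⟩
      have := hJ.xxx
      simp only [map_add, LinearMap.add_apply, hB.h12 q p, hB.h23 _ q p] at this
      linear_combination this / 3 - J1.xxx / 3 - h0 - J3.yyy / 3
    refine K1 B hB p q p' q' r ?_ Jpq J1 (J3.symm hB) hJ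
    apply LI5
    intro i0 i1 i2 i3 i4 hi
    obtain ⟨h1, h2, h3, h4, h5⟩ := key i0 i2 i3 i1 i4 (by rw [← hi]; module)
    exact ⟨h1, h4, h2, h3, h5⟩
  · exact K3 B hB p p' q' q r (LI5 _ _ _ _ _ key) J1 Jb J3 hJ h0

theorem main_pf {B : Tri} (hC : Cub B) : IsPf (fun x => B x x x) := by
  by_cases hub : NoHub B
  · by_cases npl : ∀ e1 e2 e3, ¬ Pl B e1 e2 e3
    · exact caseIII hC hub npl
    · push Not at npl
      obtain ⟨e1, e2, e3, h⟩ := npl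
      exact caseII hC h
  · unfold NoHub at hub
    push Not at hub
    obtain ⟨m0, m1, hI, hm, h⟩ := hub
    exact caseI hC m0 m1 hI hm h


/-- Every normal cubic threefold in ℙ⁴ that is not a cone is Pfaffian:
if `F` is an irreducible cubic form whose singular locus has dimension at most 1
(the Krull dimension of `ℂ[X]/(F, ∂F)` is at most 2) and which has no triple point
(the second partials vanish simultaneously only at the origin), then there is a
6×6 skew-symmetric matrix of linear forms with determinant `F ^ 2`. -/
theorem normal_cubic_threefold_pfaffian
    (F : MvPolynomial (Fin 5) ℂ) (hF : F.IsHomogeneous 3) (hirr : Irreducible F)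
    (hnormal :
      ringKrullDim
        (MvPolynomial (Fin 5) ℂ ⧸
          Ideal.span (insert F (Set.range fun i => MvPolynomial.pderiv i F))) ≤ 2)
    (hnocone : ∀ x : Fin 5 → ℂ,
      (∀ i j : Fin 5,
        MvPolynomial.eval x (MvPolynomial.pderiv i (MvPolynomial.pderiv j F)) = 0) → x = 0) :
    ∃ M : Matrix (Fin 6) (Fin 6) (MvPolynomial (Fin 5) ℂ),
      (∀ i j, (M i j).IsHomogeneous 1) ∧ Mᵀ = -M ∧ M.det = F ^ 2 := by
  obtain ⟨B, hC, hB⟩ := exists_cub F hF hirr hnocone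
  exact pf_final F (by simpa only [hB] using main_pf hC)
end

section
/- Let l₁, l₂ ∈ ℂ[X₀,…,X₄] be two linearly independent homogeneous linear forms and let a, b, c ∈ ℂ[X₀,…,X₄] be homogeneous linear forms, and set F = a·l₁² + b·l₁·l₂ + c·l₂² (so that the cubic hypersurface {F=0} ⊂ ℙ⁴ is singular along the 2-plane {l₁ = l₂ = 0}). Then there exists a 6×6 matrix M of homogeneous linear forms in X₀,…,X₄ with Mᵀ = −M and det M = F². -/
open MvPolynomial Matrix

/-- Every cubic threefold singular along a 2-plane is Pfaffian: if
`F = a·l₁² + b·l₁·l₂ + c·l₂²` with `l₁, l₂` linearly independent linear forms and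
`a, b, c` linear forms, then there is a 6×6 skew-symmetric matrix of linear forms
with determinant `F ^ 2`. -/
theorem cubic_singular_along_plane_pfaffian
    (l₁ l₂ a b c : MvPolynomial (Fin 5) ℂ)
    (hl₁ : l₁.IsHomogeneous 1) (hl₂ : l₂.IsHomogeneous 1)
    (hind : LinearIndependent ℂ ![l₁, l₂])
    (ha : a.IsHomogeneous 1) (hb : b.IsHomogeneous 1) (hc : c.IsHomogeneous 1)
    (F : MvPolynomial (Fin 5) ℂ)
    (hFdef : F = a * l₁ ^ 2 + b * l₁ * l₂ + c * l₂ ^ 2) :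
    ∃ M : Matrix (Fin 6) (Fin 6) (MvPolynomial (Fin 5) ℂ),
      (∀ i j, (M i j).IsHomogeneous 1) ∧ Mᵀ = -M ∧ M.det = F ^ 2 := by
  have hz : (0 : MvPolynomial (Fin 5) ℂ).IsHomogeneous 1 := isHomogeneous_zero _ _ _
  refine ⟨!![0, 0, 0, a, b, c;
             0, 0, 0, -l₂, l₁, 0;
             0, 0, 0, 0, -l₂, l₁;
             -a, l₂, 0, 0, 0, 0;
             -b, -l₁, l₂, 0, 0, 0;
             -c, 0, -l₁, 0, 0, 0], ?_, ?_, ?_⟩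
  · intro i j
    fin_cases i <;> fin_cases j <;>
      first
      | exact hz | exact ha | exact hb | exact hc | exact hl₁ | exact hl₂
      | exact ha.neg | exact hb.neg | exact hc.neg | exact hl₁.neg | exact hl₂.neg
  · ext1 i j
    fin_cases i <;> fin_cases j <;> simp
  · subst hFdef
    simp [Matrix.det_succ_row_zero, Fin.sum_univ_succ, Fin.succAbove]
    ring
end

section
/- Let l ∈ ℂ[X₀,…,X₄] be a homogeneous linear form and Q ∈ ℂ[X₀,…,X₄] a homogeneous quadratic form, and set F = l·Q (so that the cubic threefold {F=0} ⊂ ℙ⁴ is non-integral, the union of a hyperplane and a quadric hypersurface). Then there exists a 6×6 matrix M of homogeneous linear forms in X₀,…,X₄ with Mᵀ = −M and det M = F². -/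
open MvPolynomial Matrix

lemma aux_det {R : Type*} [CommRing R] (l a b c d e f : R) :
    (!![0, l, 0, 0, 0, 0; -l, 0, 0, 0, 0, 0; 0, 0, 0, a, c, e; 0, 0, -a, 0, f, -d;
      0, 0, -c, -f, 0, b; 0, 0, -e, d, -b, 0] : Matrix (Fin 6) (Fin 6) R).det
      = (l * (a * b + c * d + e * f)) ^ 2 := by
  simp [det_succ_row_zero, Fin.sum_univ_succ, Fin.succAbove]
  ring

lemma aux_quad (Q : MvPolynomial (Fin 5) ℂ) (hQ : Q.IsHomogeneous 2) :
    ∃ q : QuadraticForm ℂ (Fin 5 → ℂ), ∀ v, q v = eval v Q := by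
  have key : ∀ d ∈ Q.support, ∃ q : QuadraticForm ℂ (Fin 5 → ℂ),
      ∀ v, q v = eval v (monomial d (coeff d Q)) := by
    intro d hd
    have h2 : d.degree = 2 := by
      by_contra h
      exact (mem_support_iff.mp hd) (hQ.coeff_eq_zero h)
    have h3 : (Finsupp.toMultiset d).card = 2 := by
      rw [Finsupp.card_toMultiset]
      exact h2
    obtain ⟨i, j, hij⟩ := Multiset.card_eq_two.mp h3
    have h4 : d = Finsupp.single i 1 + Finsupp.single j 1 := by
      apply Multiset.toFinsupp.symm.injective
      change Finsupp.toMultiset d = Finsupp.toMultiset _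
      rw [hij, map_add, Finsupp.toMultiset_single, Finsupp.toMultiset_single]
      simp
    refine ⟨coeff d Q • QuadraticMap.linMulLin (LinearMap.proj i) (LinearMap.proj j), ?_⟩
    intro v
    generalize coeff d Q = c
    have h5 : monomial d c = C c * (X i * X j) := by
      rw [h4, X, X, monomial_mul, C_mul_monomial]
      simp
    rw [h5]
    simp
  choose! q hq using key
  refine ⟨∑ d ∈ Q.support, q d, fun v => ?_⟩
  conv_rhs => rw [Q.as_sum]
  rw [_root_.sum_apply, map_sum]
  exact Finset.sum_congr rfl fun d hd => hq d hd v

lemma aux_diag (q : QuadraticForm ℂ (Fin 5 → ℂ)) :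
    ∃ (w : Fin 5 → ℂ) (e : (Fin 5 → ℂ) →ₗ[ℂ] (Fin 5 → ℂ)),
      ∀ v, q v = ∑ i, w i * (e v i) ^ 2 := by
  obtain ⟨w, ⟨e⟩⟩ := q.equivalent_weightedSumSquares
  have hn : Module.finrank ℂ (Fin 5 → ℂ) = 5 := by simp
  revert w e
  rw [hn]
  intro w e
  refine ⟨w, e.toLinearEquiv.toLinearMap, fun v => ?_⟩
  rw [← e.map_app v, QuadraticMap.weightedSumSquares_apply]
  simp [pow_two]

lemma aux_squares (Q : MvPolynomial (Fin 5) ℂ) (hQ : Q.IsHomogeneous 2) :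
    ∃ s : Fin 5 → MvPolynomial (Fin 5) ℂ, (∀ i, (s i).IsHomogeneous 1) ∧
      Q = ∑ i, s i ^ 2 := by
  obtain ⟨q, hq⟩ := aux_quad Q hQ
  obtain ⟨w, e, he⟩ := aux_diag q
  have hr : ∀ i, ∃ r : ℂ, r ^ 2 = w i := fun i =>
    IsAlgClosed.exists_pow_nat_eq (w i) (by norm_num)
  choose r hr using hr
  refine ⟨fun i => ∑ j, C (r i * e (Pi.single j 1) i) * X j, fun i => ?_, ?_⟩
  · refine IsHomogeneous.sum _ _ _ fun j _ => ?_
    generalize r i * e (Pi.single j 1) i = t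
    have h := (isHomogeneous_C (Fin 5) t).mul (isHomogeneous_X ℂ j)
    rwa [zero_add] at h
  · apply MvPolynomial.funext
    intro v
    rw [← hq, he, map_sum]
    refine Finset.sum_congr rfl fun i _ => ?_
    have h1 : e v i = ∑ j, e (Pi.single j 1) i * v j := by
      conv_lhs => rw [LinearMap.pi_apply_eq_sum_univ e v]
      simp only [Finset.sum_apply, Pi.smul_apply, smul_eq_mul]
      refine Finset.sum_congr rfl fun j _ => ?_
      rw [mul_comm]
      congr 2
      refine congrArg (fun u => e u i) ?_
      funext k
      simp [Pi.single_apply, eq_comm]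
    rw [← hr, h1, ← mul_pow, map_pow, map_sum, Finset.mul_sum]
    simp [mul_assoc]

/-- Every non-integral cubic threefold is Pfaffian: if `F = l·Q` with `l` a linear
form and `Q` a quadratic form, then there is a 6×6 skew-symmetric matrix of linear
forms with determinant `F ^ 2`. -/
theorem non_integral_cubic_pfaffian
    (l Q : MvPolynomial (Fin 5) ℂ)
    (hl : l.IsHomogeneous 1) (hQ : Q.IsHomogeneous 2)
    (F : MvPolynomial (Fin 5) ℂ) (hFdef : F = l * Q) :
    ∃ M : Matrix (Fin 6) (Fin 6) (MvPolynomial (Fin 5) ℂ),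
      (∀ i j, (M i j).IsHomogeneous 1) ∧ Mᵀ = -M ∧ M.det = F ^ 2 := by
  obtain ⟨s, hs, hsum⟩ := aux_squares Q hQ
  have hI : ∀ i, (C Complex.I * s i).IsHomogeneous 1 := fun i => by
    simpa using (isHomogeneous_C _ _).mul (hs i)
  have hII : (C Complex.I * C Complex.I : MvPolynomial (Fin 5) ℂ) = -1 := by
    rw [← C_mul, Complex.I_mul_I]; simp
  have hfac : Q = (s 0 + C Complex.I * s 1) * (s 0 - C Complex.I * s 1)
      + (s 2 + C Complex.I * s 3) * (s 2 - C Complex.I * s 3) + s 4 * s 4 := by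
    rw [hsum, Fin.sum_univ_five]
    linear_combination (s 1 ^ 2 + s 3 ^ 2) * hII
  have ha := (hs 0).add (hI 1)
  have hb := (hs 0).sub (hI 1)
  have hc := (hs 2).add (hI 3)
  have hd := (hs 2).sub (hI 3)
  have he := hs 4
  have h0 := isHomogeneous_zero (Fin 5) ℂ 1
  rw [hFdef, hfac]
  generalize s 0 + C Complex.I * s 1 = a at *
  generalize s 0 - C Complex.I * s 1 = b at *
  generalize s 2 + C Complex.I * s 3 = c at *
  generalize s 2 - C Complex.I * s 3 = d at *
  generalize s 4 = f at *
  refine ⟨_, ?_, ?_, aux_det l a b c d f f⟩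
  · intro i j
    fin_cases i <;> fin_cases j <;>
      first
      | exact h0 | exact hl | exact ha | exact hb | exact hc | exact hd | exact he
      | exact hl.neg | exact ha.neg | exact hb.neg | exact hc.neg | exact hd.neg | exact he.neg
  · ext1 i j
    fin_cases i <;> fin_cases j <;> simp
end
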